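/- arXiv:2109.06521 — 3 statements merged into one kernel-verified Lean document; each statement's English description precedes it below -/
import Mathlib

section
/- Let G = (ρ, V, w) be a rooted directed weighted graph with N ≥ 1 non-root nodes and let L be its root-weighted Laplacian. Then det L = ∑_{t∈D(G)} ∏_{(i,j)∈t} w_{ij}; i.e., the determinant of L equals the normalizing constant Z over dependency trees (the Matrix–Tree Theorem in the single-root form of Koo et al.). -/
/-!
Nodes of a rooted directed weighted graph with `N` non-root nodes are encoded as
`Fin (N + 1)`, with the root `ρ` being `0` and the non-root nodes `1, …, N` being
`j.succ` for `j : Fin N`.  A candidate (spanning) tree is encoded by a parent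
function `par : Fin N → Fin (N + 1)` assigning to each non-root node `j` the tail
of its unique incoming edge `(par j, j.succ)`.
-/

/-- One step upwards towards the root along the parent function (the root is a fixed point). -/
def Step {N : ℕ} (par : Fin N → Fin (N + 1)) : Fin (N + 1) → Fin (N + 1) :=
  fun v => if h : v = 0 then 0 else par (v.pred h)

/-- `par` encodes a directed spanning tree rooted at `0`: every node has exactly one
incoming edge (built into the encoding) and there are no cycles, i.e. every node
reaches the root. -/
def IsSTree {N : ℕ} (par : Fin N → Fin (N + 1)) : Prop :=
  ∀ v : Fin (N + 1), (Step par)^[N] v = 0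

instance {N : ℕ} (par : Fin N → Fin (N + 1)) : Decidable (IsSTree par) :=
  inferInstanceAs (Decidable (∀ v : Fin (N + 1), (Step par)^[N] v = 0))

/-- A dependency tree: a spanning tree with exactly one edge emanating from the root. -/
def IsDTree {N : ℕ} (par : Fin N → Fin (N + 1)) : Prop :=
  IsSTree par ∧ (Finset.univ.filter fun j : Fin N => par j = 0).card = 1

instance {N : ℕ} (par : Fin N → Fin (N + 1)) : Decidable (IsDTree par) :=
  inferInstanceAs (Decidable (IsSTree par ∧
    (Finset.univ.filter fun j : Fin N => par j = 0).card = 1))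

/-- The weight of a tree: the product of its edge weights. -/
def treeWeight {N : ℕ} (w : Fin (N + 1) → Fin (N + 1) → ℝ)
    (par : Fin N → Fin (N + 1)) : ℝ :=
  ∏ j : Fin N, w (par j) j.succ

/-- The root-weighted Laplacian of Koo et al.: rows/columns indexed by the non-root
nodes `1, …, N+1` (encoded as `Fin (N+1)`, with node "1" being index `0`); the first
row holds the root edge weights, the other diagonal entries hold the total non-root
incoming weight, and off-diagonal entries are negated edge weights. -/
def rootLap {N : ℕ} (w : Fin (N + 2) → Fin (N + 2) → ℝ) :
    Matrix (Fin (N + 1)) (Fin (N + 1)) ℝ :=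
  Matrix.of fun i j =>
    if i = 0 then w 0 j.succ
    else if i = j then ∑ i' ∈ Finset.univ.erase j, w i'.succ j.succ
    else -w i.succ j.succ

/-- The signed incidence matrix of a parent function, with the row of the first non-root
node replaced by the indicator of the root edges. -/
def rootIncidence {N : ℕ} (par : Fin (N + 1) → Fin (N + 2)) :
    Matrix (Fin (N + 1)) (Fin (N + 1)) ℝ :=
  Matrix.of fun i j =>
    if i = 0 then (if par j = 0 then 1 else 0)
    else if par j = 0 then 0
    else (if i = j then 1 else 0) - (if i.succ = par j then 1 else 0)

/-- The adjacency matrix of a parent function, restricted to the non-root nodes. -/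
def parentMatrix {N : ℕ} (par : Fin N → Fin (N + 1)) : Matrix (Fin N) (Fin N) ℝ :=
  Matrix.of fun i j => if i.succ = par j then 1 else 0

@[simp] lemma step_zero {N : ℕ} (par : Fin N → Fin (N + 1)) : Step par 0 = 0 := by
  simp [Step]

@[simp] lemma step_succ {N : ℕ} (par : Fin N → Fin (N + 1)) (j : Fin N) :
    Step par j.succ = par j := by
  simp [Step]

lemma iterate_step_zero {N : ℕ} (par : Fin N → Fin (N + 1)) (k : ℕ) :
    (Step par)^[k] 0 = 0 :=
  Function.iterate_fixed (step_zero par) k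

lemma parentMatrix_pow_apply {N : ℕ} (par : Fin N → Fin (N + 1)) (k : ℕ) (i j : Fin N) :
    (parentMatrix par ^ k) i j = if i.succ = (Step par)^[k] j.succ then 1 else 0 := by
  induction k generalizing j with
  | zero => simp [Matrix.one_apply]
  | succ k ih =>
    rw [pow_succ, Matrix.mul_apply, Function.iterate_succ_apply, step_succ]
    simp only [ih]
    rcases Fin.eq_zero_or_eq_succ (par j) with h | ⟨l, h⟩
    · simp [parentMatrix, h, iterate_step_zero, Fin.succ_ne_zero]
    · simp [parentMatrix, h]

lemma parentMatrix_pow_eq_zero_iff {N : ℕ} (par : Fin N → Fin (N + 1)) (k : ℕ) :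
    parentMatrix par ^ k = 0 ↔ ∀ v, (Step par)^[k] v = 0 := by
  constructor
  · intro h v
    rcases Fin.eq_zero_or_eq_succ v with rfl | ⟨j, rfl⟩
    · exact iterate_step_zero par k
    · rcases Fin.eq_zero_or_eq_succ ((Step par)^[k] j.succ) with h0 | ⟨i, hi⟩
      · exact h0
      · have := congrFun (congrFun h i) j
        simp [parentMatrix_pow_apply, hi] at this
  · intro h
    ext i j
    simp [parentMatrix_pow_apply, h, Fin.succ_ne_zero]

lemma charpoly_eq_X_pow_of_isNilpotent {n : Type*} [Fintype n] [DecidableEq n]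
    {A : Matrix n n ℝ} (hA : IsNilpotent A) : A.charpoly = Polynomial.X ^ Fintype.card n :=
  sub_eq_zero.mp (Matrix.isNilpotent_charpoly_sub_pow_of_isNilpotent hA).eq_zero

/-- If every node eventually reaches the root, it does so within `N` steps. -/
lemma isSTree_of_forall_exists_iterate {N : ℕ} {par : Fin N → Fin (N + 1)}
    (h : ∀ v, ∃ k, (Step par)^[k] v = 0) : IsSTree par := by
  choose k hk using h
  have hnil : IsNilpotent (parentMatrix par) := by
    refine ⟨∑ v, k v, (parentMatrix_pow_eq_zero_iff par _).2 fun v => ?_⟩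
    obtain ⟨m, hm⟩ := Nat.exists_eq_add_of_le'
      (Finset.single_le_sum (fun u _ => Nat.zero_le (k u)) (Finset.mem_univ v))
    rw [hm, Function.iterate_add_apply, hk, iterate_step_zero]
  have h := Matrix.aeval_self_charpoly (parentMatrix par)
  rw [charpoly_eq_X_pow_of_isNilpotent hnil, map_pow, Polynomial.aeval_X, Fintype.card_fin] at h
  exact (parentMatrix_pow_eq_zero_iff par N).1 h

lemma det_one_sub_parentMatrix {N : ℕ} {par : Fin N → Fin (N + 1)} (h : IsSTree par) :
    (1 - parentMatrix par).det = 1 := by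
  have hnil : IsNilpotent (parentMatrix par) := ⟨N, (parentMatrix_pow_eq_zero_iff par N).2 h⟩
  have := Matrix.eval_charpoly (parentMatrix par) 1
  rw [charpoly_eq_X_pow_of_isNilpotent hnil] at this
  simpa using this.symm

/-- If the first row vanishes outside column `r`, the determinant ignores the remaining
entries of that column. -/
lemma det_eq_of_forall_ne_column {R : Type*} [CommRing R] {n : ℕ}
    {A B : Matrix (Fin (n + 1)) (Fin (n + 1)) R} (r : Fin (n + 1))
    (hA : ∀ j, j ≠ r → A 0 j = 0) (hAB : ∀ i j, j ≠ r → A i j = B i j)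
    (hr : A 0 r = B 0 r) : A.det = B.det := by
  rw [Matrix.det_succ_row_zero, Matrix.det_succ_row_zero]
  refine Finset.sum_congr rfl fun j _ => ?_
  by_cases hj : j = r
  · subst hj
    have : A.submatrix Fin.succ j.succAbove = B.submatrix Fin.succ j.succAbove := by
      ext i k
      exact hAB _ _ (Fin.succAbove_ne j k)
    rw [hr, this]
  · rw [← hAB 0 j hj, hA j hj]
    simp

lemma det_rootIncidence_of_isDTree {N : ℕ} {par : Fin (N + 1) → Fin (N + 2)}
    (h : IsDTree par) : (rootIncidence par).det = 1 := by
  obtain ⟨r, hr⟩ := Finset.card_eq_one.1 h.2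
  have hr' : ∀ j, par j = 0 ↔ j = r := fun j => by
    simpa using congrArg (j ∈ ·) hr
  have hdet := Matrix.det_updateRow_sum (1 - parentMatrix par) 0 (fun _ => 1)
  rw [det_one_sub_parentMatrix h.1, one_smul] at hdet
  have hrow : ∀ j, (∑ i, (1 - parentMatrix par) i) j = if par j = 0 then 1 else 0 := by
    intro j
    refine (Finset.sum_apply j _ _).trans ?_
    rcases Fin.eq_zero_or_eq_succ (par j) with h0 | ⟨l, hl⟩
    · simp [parentMatrix, Matrix.one_apply, h0, Fin.succ_ne_zero]
    · simp [parentMatrix, Matrix.one_apply, hl, Fin.succ_ne_zero]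
  rw [← hdet]
  refine det_eq_of_forall_ne_column r (fun j hj => by simp [rootIncidence, hr', hj])
    (fun i j hj => ?_) ?_
  · by_cases hi : i = 0
    · subst hi
      simp [rootIncidence, hrow]
    · simp [rootIncidence, hi, hr', hj, parentMatrix, Matrix.one_apply]
  · simp [rootIncidence, hrow]

lemma det_rootIncidence_of_not_isSTree {N : ℕ} {par : Fin (N + 1) → Fin (N + 2)}
    (h : ¬ IsSTree par) : (rootIncidence par).det = 0 := by
  classical
  by_cases hroot : ∃ r, par r = 0
  · obtain ⟨r, hr⟩ := hroot
    let reach : Fin (N + 2) → Prop := fun v => ∃ k, (Step par)^[k] v = 0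
    have hstep : ∀ j : Fin (N + 1), reach j.succ ↔ reach (par j) := by
      refine fun j => ⟨fun ⟨k, hk⟩ => ?_, fun ⟨k, hk⟩ => ⟨k + 1, by simpa using hk⟩⟩
      cases k with
      | zero => exact absurd hk (Fin.succ_ne_zero j)
      | succ k => exact ⟨k, by simpa using hk⟩
    have hreach_r : reach r.succ := ⟨1, by simpa using hr⟩
    obtain ⟨u, hu⟩ : ∃ u : Fin (N + 1), ¬ reach u.succ := by
      by_contra! hall
      refine h (isSTree_of_forall_exists_iterate fun v => ?_)
      rcases Fin.eq_zero_or_eq_succ v with rfl | ⟨j, rfl⟩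
      · exact ⟨0, rfl⟩
      · exact hall j
    let f : Fin (N + 1) → ℝ := fun i =>
      if (reach i.succ ↔ reach 1) then 0 else 1
    have hf0 : f 0 = 0 := by simp [f]
    refine Matrix.exists_vecMul_eq_zero_iff.1 ⟨f, fun hf => ?_, ?_⟩
    · have h1 := congrFun hf r
      have h2 := congrFun hf u
      by_cases h0 : reach 1
      · simp [f, hu, h0] at h2
      · simp [f, hreach_r, h0] at h1
    · ext j
      have hterm : ∀ i, f i * rootIncidence par i j =
          if par j = 0 then 0
          else f i * ((if i = j then 1 else 0) - (if i.succ = par j then 1 else 0)) := by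
        intro i
        by_cases hi : i = 0
        · simp [hi, hf0]
        · simp [rootIncidence, hi]
      simp only [Matrix.vecMul, dotProduct, hterm]
      rcases Fin.eq_zero_or_eq_succ (par j) with h0 | ⟨l, hl⟩
      · simp [h0]
      · have : f j = f l := by simp only [f, hstep j, hl]
        simp [hl, Fin.succ_ne_zero, mul_sub, this]
  · push Not at hroot
    exact Matrix.det_eq_zero_of_row_eq_zero 0 fun j => by simp [rootIncidence, hroot]

lemma det_rootIncidence {N : ℕ} (par : Fin (N + 1) → Fin (N + 2)) :
    (rootIncidence par).det = if IsDTree par then 1 else 0 := by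
  split_ifs with h
  · exact det_rootIncidence_of_isDTree h
  by_cases hS : IsSTree par
  · have hcard : (Finset.univ.filter fun j => par j = 0).card ≠ 1 := fun hc => h ⟨hS, hc⟩
    rcases Nat.lt_or_gt_of_ne hcard with hlt | hgt
    · have hempty := Finset.card_eq_zero.1 (Nat.lt_one_iff.1 hlt)
      refine Matrix.det_eq_zero_of_row_eq_zero 0 fun j => ?_
      have : par j ≠ 0 := by simpa using Finset.filter_eq_empty_iff.1 hempty (Finset.mem_univ j)
      simp [rootIncidence, this]
    · obtain ⟨a, ha, b, hb, hab⟩ := Finset.one_lt_card.1 hgt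
      simp only [Finset.mem_filter, Finset.mem_univ, true_and] at ha hb
      exact Matrix.det_zero_of_column_eq hab fun i => by simp [rootIncidence, ha, hb]
  · exact det_rootIncidence_of_not_isSTree hS

lemma rootLap_apply_eq_sum {N : ℕ} (w : Fin (N + 2) → Fin (N + 2) → ℝ) (i j : Fin (N + 1)) :
    rootLap w i j = ∑ p, w p j.succ * rootIncidence (fun _ => p) i j := by
  rw [Fin.sum_univ_succ]
  by_cases hi : i = 0
  · simp [rootLap, rootIncidence, hi, Fin.succ_ne_zero]
  · by_cases hij : i = j
    · subst hij
      simp [rootLap, rootIncidence, hi, Fin.succ_ne_zero, mul_sub, Finset.sum_erase_eq_sub]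
    · simp [rootLap, rootIncidence, hi, hij, Fin.succ_ne_zero]

/-- Matrix–Tree theorem, single-root form of Koo et al..
For a rooted directed weighted graph with `N + 1 ≥ 1` non-root nodes,
`det L = ∑_{t ∈ D(G)} ∏_{(i,j) ∈ t} w_{ij}`, the normalizing constant over
dependency trees. -/
theorem det_rootLap_eq_sum_dtrees {N : ℕ}
    (w : Fin (N + 2) → Fin (N + 2) → ℝ) (hw : ∀ i j, 0 ≤ w i j) :
    (rootLap w).det
      = ∑ t : Fin (N + 1) → Fin (N + 2), if IsDTree t then treeWeight w t else 0 := by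
  have hincidence : ∀ (t : Fin (N + 1) → Fin (N + 2)) i j,
      rootIncidence (fun _ => t j) i j = rootIncidence t i j := fun _ _ _ => rfl
  calc (rootLap w).det
      = ∑ t : Fin (N + 1) → Fin (N + 2), treeWeight w t * (rootIncidence t).det := by
        simp only [Matrix.det_apply', rootLap_apply_eq_sum, Finset.prod_univ_sum,
          Fintype.piFinset_univ, Finset.mul_sum]
        rw [Finset.sum_comm]
        refine Finset.sum_congr rfl fun t _ => Finset.sum_congr rfl fun σ _ => ?_
        simp only [hincidence, Finset.prod_mul_distrib, treeWeight]
        ring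
    _ = _ := by simp [det_rootIncidence]
end

section
/- Let G = (ρ, V, w) be a rooted directed weighted graph and let j be a non-root node. Let G' be the graph obtained from G by deleting the root ρ (and all edges incident to it) and designating j as the new root, with weights w'_{ik} = w_{ik} for i, k ∈ V∖{ρ}, k ≠ j. Then the map t ↦ t ∖ {(ρ, j)} is a bijection from {t ∈ D(G) : (ρ, j) ∈ t} onto T(G'), and for every such t, w(t) = w_{ρj} · w'(t ∖ {(ρ, j)}). Consequently ∑_{t∈D(G), (ρ,j)∈t} w(t) = w_{ρj} · ∑_{t'∈T(G')} w'(t'). -/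
/-- One step upwards along a parent function on the node set `V ∖ {ρ} ≃ Fin N`,
with `r` designated as the root (a fixed point). -/
def StepAt {N : ℕ} (r : Fin N) (par : Fin N → Fin N) : Fin N → Fin N :=
  fun v => if v = r then r else par v

/-- `par` encodes a directed spanning tree of the graph on the node set
`V ∖ {ρ} ≃ Fin N` rooted at `r` (the value `par r = r` is fixed by convention). -/
def IsSTreeAt {N : ℕ} (r : Fin N) (par : Fin N → Fin N) : Prop :=
  ∀ v : Fin N, (StepAt r par)^[N] v = r

instance {N : ℕ} (r : Fin N) (par : Fin N → Fin N) : Decidable (IsSTreeAt r par) :=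
  inferInstanceAs (Decidable (∀ v : Fin N, (StepAt r par)^[N] v = r))

/-- The map `t ↦ t ∖ {(ρ, j)}`: a dependency tree of `G` whose root edge is `(ρ, j)`
is sent to the corresponding tree on `V ∖ {ρ} ≃ Fin N` rooted at `j` (with parents
re-indexed by `Fin.pred`, and `j` mapped to itself by convention). -/
def Phi {N : ℕ} (j : Fin N) (par : Fin N → Fin (N + 1)) : Fin N → Fin N :=
  fun v => if h : par v = 0 then j else (par v).pred h

/-- On a finite type with `n + 1` elements, a point whose orbit reaches a fixed point `r` reaches
it within `n` steps. -/
theorem iterate_eq_of_card_le {α : Type*} [Fintype α] {f : α → α} {r : α} (hr : f r = r)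
    {n m : ℕ} (hn : Fintype.card α ≤ n + 1) {v : α} (h : f^[m] v = r) : f^[n] v = r := by
  classical
  have hex : ∃ k, f^[k] v = r := ⟨m, h⟩
  have hk : f^[Nat.find hex] v = r := Nat.find_spec hex
  have hmin : ∀ i < Nat.find hex, f^[i] v ≠ r := fun i hi => Nat.find_min hex hi
  generalize Nat.find hex = k at hk hmin
  have hlt : ∀ a b : ℕ, a < b → b ≤ k → f^[a] v ≠ f^[b] v := by
    intro a b hab hb heq
    refine hmin (k - b + a) (by omega) ?_
    rw [Function.iterate_add_apply, heq, ← Function.iterate_add_apply, Nat.sub_add_cancel hb, hk]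
  have hinj : Function.Injective fun i : Fin (k + 1) => f^[(i : ℕ)] v := by
    intro a b hab
    rcases lt_trichotomy (a : ℕ) b with hl | he | hl
    · exact absurd hab (hlt _ _ hl (by omega))
    · exact Fin.ext he
    · exact absurd hab.symm (hlt _ _ hl (by omega))
  have hcard := Fintype.card_le_of_injective _ hinj
  rw [Fintype.card_fin] at hcard
  rw [← Nat.sub_add_cancel (show k ≤ n by omega), Function.iterate_add_apply, hk,
    Function.iterate_fixed hr]

/-- Adding the root edge `(ρ, j)` to a tree on `V ∖ {ρ}` rooted at `j`; the inverse of `Phi j`. -/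
def addRootEdge {N : ℕ} (j : Fin N) (t' : Fin N → Fin N) : Fin N → Fin (N + 1) :=
  fun v => if v = j then 0 else (t' v).succ

theorem addRootEdge_eq_zero_iff {N : ℕ} (j : Fin N) (t' : Fin N → Fin N) (v : Fin N) :
    addRootEdge j t' v = 0 ↔ v = j := by
  simp [addRootEdge]

theorem addRootEdge_self {N : ℕ} (j : Fin N) (t' : Fin N → Fin N) : addRootEdge j t' j = 0 :=
  (addRootEdge_eq_zero_iff j t' j).2 rfl

theorem Phi_addRootEdge {N : ℕ} {j : Fin N} {t' : Fin N → Fin N} (h : t' j = j) :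
    Phi j (addRootEdge j t') = t' := by
  funext v
  by_cases hv : v = j
  · simp [Phi, addRootEdge, hv, h]
  · simp [Phi, addRootEdge, hv]

theorem addRootEdge_Phi {N : ℕ} {j : Fin N} {t : Fin N → Fin (N + 1)}
    (h : ∀ v, t v = 0 ↔ v = j) : addRootEdge j (Phi j t) = t := by
  funext v
  by_cases hv : v = j
  · simp [addRootEdge, hv, (h j).2 rfl]
  · have := mt (h v).1 hv
    simp [Phi, addRootEdge, hv, this]

theorem Phi_self {N : ℕ} {j : Fin N} {t : Fin N → Fin (N + 1)} (h : t j = 0) :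
    Phi j t j = j := by
  simp [Phi, h]

theorem IsDTree.eq_zero_iff {N : ℕ} {j : Fin N} {t : Fin N → Fin (N + 1)}
    (ht : IsDTree t) (hj : t j = 0) (v : Fin N) : t v = 0 ↔ v = j := by
  refine ⟨fun hv => ?_, fun hv => hv ▸ hj⟩
  exact Finset.card_le_one.1 ht.2.le v (by simpa using hv) j (by simpa using hj)

theorem StepAt_self {N : ℕ} (j : Fin N) (t' : Fin N → Fin N) : StepAt j t' j = j := by
  simp [StepAt]

theorem Step_zero {N : ℕ} (t : Fin N → Fin (N + 1)) : Step t 0 = 0 := by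
  simp [Step]

theorem Step_succ {N : ℕ} (t : Fin N → Fin (N + 1)) (v : Fin N) : Step t v.succ = t v := by
  simp [Step]

theorem iterate_Step_addRootEdge {N : ℕ} (j : Fin N) (t' : Fin N → Fin N) (n : ℕ) (v : Fin N) :
    (Step (addRootEdge j t'))^[n + 1] v.succ = 0 ↔ (StepAt j t')^[n] v = j := by
  induction n generalizing v with
  | zero => simp [Step_succ, addRootEdge_eq_zero_iff]
  | succ n ih =>
    rw [Function.iterate_succ_apply, Step_succ, Function.iterate_succ_apply (StepAt j t')]
    by_cases hv : v = j
    · subst hv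
      rw [addRootEdge_self, StepAt_self, Function.iterate_fixed (Step_zero _),
        Function.iterate_fixed (StepAt_self _ _)]
      simp
    · have h : addRootEdge j t' v = (t' v).succ := if_neg hv
      have h' : StepAt j t' v = t' v := if_neg hv
      rw [h, h', ih]

theorem isSTree_addRootEdge_iff {N : ℕ} (j : Fin N) (t' : Fin N → Fin N) :
    IsSTree (addRootEdge j t') ↔ IsSTreeAt j t' := by
  obtain ⟨M, rfl⟩ : ∃ M, N = M + 1 := ⟨N - 1, by have := j.pos; omega⟩
  rw [IsSTree, IsSTreeAt, Fin.forall_fin_succ]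
  simp only [iterate_Step_addRootEdge]
  refine ⟨fun h v => ?_, fun h => ⟨Function.iterate_fixed (Step_zero _) _, fun v => ?_⟩⟩
  · rw [Function.iterate_succ_apply', h.2 v, StepAt_self]
  · exact iterate_eq_of_card_le (StepAt_self j t') (Fintype.card_fin _).le (h v)

theorem isDTree_addRootEdge_iff {N : ℕ} (j : Fin N) (t' : Fin N → Fin N) :
    IsDTree (addRootEdge j t') ↔ IsSTreeAt j t' := by
  rw [IsDTree, isSTree_addRootEdge_iff]
  simp [addRootEdge_eq_zero_iff, Finset.filter_eq']

theorem bijOn_Phi {N : ℕ} (j : Fin N) :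
    Set.BijOn (Phi j) {t : Fin N → Fin (N + 1) | IsDTree t ∧ t j = 0}
      {t' : Fin N → Fin N | IsSTreeAt j t' ∧ t' j = j} := by
  refine Set.InvOn.bijOn (f' := addRootEdge j) ⟨?_, ?_⟩ ?_ ?_
  · exact fun t ht => addRootEdge_Phi (ht.1.eq_zero_iff ht.2)
  · exact fun t' ht' => Phi_addRootEdge ht'.2
  · intro t ht
    refine ⟨?_, Phi_self ht.2⟩
    rw [← isDTree_addRootEdge_iff, addRootEdge_Phi (ht.1.eq_zero_iff ht.2)]
    exact ht.1
  · exact fun t' ht' => ⟨(isDTree_addRootEdge_iff j t').2 ht'.1, addRootEdge_self j t'⟩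

theorem treeWeight_addRootEdge {N : ℕ} (w : Fin (N + 1) → Fin (N + 1) → ℝ) (j : Fin N)
    (t' : Fin N → Fin N) :
    treeWeight w (addRootEdge j t')
      = w 0 j.succ * ∏ v ∈ Finset.univ.erase j, w (t' v).succ v.succ := by
  rw [treeWeight, ← Finset.mul_prod_erase _ _ (Finset.mem_univ j), addRootEdge_self]
  congr 1
  refine Finset.prod_congr rfl fun v hv => ?_
  rw [addRootEdge, if_neg (Finset.ne_of_mem_erase hv)]

theorem IsDTree.treeWeight_eq {N : ℕ} (w : Fin (N + 1) → Fin (N + 1) → ℝ) {j : Fin N}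
    {t : Fin N → Fin (N + 1)} (ht : IsDTree t) (hj : t j = 0) :
    treeWeight w t
      = w 0 j.succ * ∏ v ∈ Finset.univ.erase j, w (Phi j t v).succ v.succ := by
  rw [← treeWeight_addRootEdge, addRootEdge_Phi (ht.eq_zero_iff hj)]

/-- Let `G'` be the graph obtained from `G` by deleting the root
`ρ` and designating the non-root node `j` as the new root, with weights
`w'_{ik} = w_{ik}`.  Then `t ↦ t ∖ {(ρ, j)}` is a bijection from
`{t ∈ D(G) : (ρ, j) ∈ t}` onto `T(G')`; for every such `t`,
`w(t) = w_{ρj} · w'(t ∖ {(ρ, j)})`; and consequently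
`∑_{t ∈ D(G), (ρ,j) ∈ t} w(t) = w_{ρj} · ∑_{t' ∈ T(G')} w'(t')`. -/
theorem root_edge_reduction {N : ℕ}
    (w : Fin (N + 1) → Fin (N + 1) → ℝ) (hw : ∀ i k, 0 ≤ w i k)
    (j : Fin N) :
    Set.BijOn (Phi j)
        {t : Fin N → Fin (N + 1) | IsDTree t ∧ t j = 0}
        {t' : Fin N → Fin N | IsSTreeAt j t' ∧ t' j = j}
    ∧ (∀ t : Fin N → Fin (N + 1), IsDTree t → t j = 0 →
        treeWeight w t
          = w 0 j.succ * ∏ v ∈ Finset.univ.erase j, w ((Phi j t) v).succ v.succ)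
    ∧ (∑ t : Fin N → Fin (N + 1), if IsDTree t ∧ t j = 0 then treeWeight w t else 0)
        = w 0 j.succ * ∑ t' : Fin N → Fin N,
            if IsSTreeAt j t' ∧ t' j = j
            then ∏ v ∈ Finset.univ.erase j, w (t' v).succ v.succ else 0 := by
  have hbij := bijOn_Phi j
  refine ⟨hbij, fun t ht hj => ht.treeWeight_eq w hj, ?_⟩
  rw [← Finset.sum_filter, ← Finset.sum_filter, Finset.mul_sum]
  refine Finset.sum_bij (fun t _ => Phi j t) ?_ ?_ ?_ ?_
  · intro t ht
    simpa using hbij.mapsTo (by simpa using ht)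
  · intro t ht s hs h
    exact hbij.injOn (by simpa using ht) (by simpa using hs) h
  · intro t' ht'
    obtain ⟨t, ht, h⟩ := hbij.surjOn (Finset.mem_filter.1 ht').2
    exact ⟨t, by simpa using ht, h⟩
  · intro t ht
    have h := (Finset.mem_filter.1 ht).2
    exact h.1.treeWeight_eq w h.2
end

section
/- There exists a rooted directed weighted graph G = (ρ, V, w) with Z_D = ∑_{t∈D(G)} w(t) > 0 and ∑_{j'} w_{ρj'} > 0, and a non-root node j, such that w_{ρj} / (∑_{j'} w_{ρj'}) ≠ (∑_{t∈D(G), (ρ,j)∈t} w(t)) / Z_D. In other words, sampling the root edge with probability proportional to its edge weight does not in general agree with the marginal probability of that root edge under the dependency-tree distribution p(t) = w(t)/Z_D, so the procedure that first samples the root edge by its weight and then a tree given that edge yields a biased sample of dependency trees. -/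
/-- The graph on `Fin (N + 1)` with unit edges `(a, b)` for `a < b`. -/
def increasingWeight (N : ℕ) (a b : Fin (N + 1)) : ℝ := if a < b then 1 else 0

theorem treeWeight_increasingWeight {N : ℕ} (t : Fin N → Fin (N + 1)) :
    treeWeight (increasingWeight N) t = if ∀ j, t j < j.succ then 1 else 0 := by
  simp [treeWeight, increasingWeight, Finset.prod_ite_zero]

theorem isDTree_and_increasing_iff (t : Fin 2 → Fin 3) :
    (IsDTree t ∧ ∀ j, t j < j.succ) ↔ t = ![0, 1] := by
  revert t
  decide

theorem sum_isDTree_increasingWeight :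
    (∑ t : Fin 2 → Fin 3, if IsDTree t then treeWeight (increasingWeight 2) t else 0) = 1 := by
  simp only [treeWeight_increasingWeight, ← ite_and, isDTree_and_increasing_iff]
  simp

theorem sum_isDTree_root_edge_increasingWeight :
    (∑ t : Fin 2 → Fin 3,
      if IsDTree t ∧ t 0 = 0 then treeWeight (increasingWeight 2) t else 0) = 1 := by
  have h (t : Fin 2 → Fin 3) :
      ((IsDTree t ∧ t 0 = 0) ∧ ∀ j, t j < j.succ) ↔ t = ![0, 1] := by
    rw [and_right_comm, isDTree_and_increasing_iff, and_iff_left_iff_imp]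
    rintro rfl
    rfl
  simp only [treeWeight_increasingWeight, ← ite_and, h]
  simp

/-- There is a rooted directed weighted graph (with no self-loops
and no edges into the root) whose dependency-tree partition function
`Z_D = ∑_{t ∈ D(G)} w(t)` is positive and whose total root edge weight
`∑_{j'} w_{ρ j'}` is positive, together with a non-root node `j`, such that the
locally normalized root edge weight `w_{ρj} / ∑_{j'} w_{ρj'}` differs from the
marginal probability `(∑_{t ∈ D(G), (ρ,j) ∈ t} w(t)) / Z_D` of the root edge
`(ρ, j)` under `p(t) = w(t)/Z_D`: sampling the root edge by its weight yields a
biased sample of dependency trees. -/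
theorem root_edge_sampling_biased :
    ∃ (N : ℕ) (w : Fin (N + 1) → Fin (N + 1) → ℝ) (j : Fin N),
      (∀ a b, 0 ≤ w a b) ∧
      (∀ a, w a a = 0) ∧
      (∀ a, w a 0 = 0) ∧
      (0 < ∑ t : Fin N → Fin (N + 1), if IsDTree t then treeWeight w t else 0) ∧
      (0 < ∑ j' : Fin N, w 0 j'.succ) ∧
      w 0 j.succ / (∑ j' : Fin N, w 0 j'.succ)
        ≠ (∑ t : Fin N → Fin (N + 1), if IsDTree t ∧ t j = 0 then treeWeight w t else 0)
            / (∑ t : Fin N → Fin (N + 1), if IsDTree t then treeWeight w t else 0) := by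
  have hroot : ∑ j' : Fin 2, increasingWeight 2 0 j'.succ = 2 := by
    simp [increasingWeight]
  refine ⟨2, increasingWeight 2, 0, fun a b => ?_, fun a => ?_, fun a => ?_, ?_, ?_, ?_⟩
  · unfold increasingWeight
    split_ifs <;> norm_num
  · simp [increasingWeight]
  · simp [increasingWeight]
  · rw [sum_isDTree_increasingWeight]
    exact one_pos
  · rw [hroot]
    exact two_pos
  · rw [hroot, sum_isDTree_root_edge_increasingWeight, sum_isDTree_increasingWeight]
    norm_num [increasingWeight]
end
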